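/- For every k ≥ 2, the measure μ_k admits the representation μ_k = 3^{−k}(δ_{z₀} + δ_{z₁} + δ_{z₂}) + 2·3^{−k} Σ_{x ∈ A_k \ A₁} δ_x. -/

import Mathlib

open MeasureTheory Metric Set
open scoped ENNReal

noncomputable section

/-- The point `(a, b)` of the Euclidean plane. -/
def pt (a b : ℝ) : EuclideanSpace ℝ (Fin 2) := (WithLp.equiv 2 (Fin 2 → ℝ)).symm ![a, b]

/-- The translation vectors of the three similitudes. -/
def v : Fin 3 → EuclideanSpace ℝ (Fin 2)
  | 0 => pt 0 0
  | 1 => pt (1/2) 0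
  | 2 => pt (1/4) (Real.sqrt 3 / 4)

/-- The three similitudes generating the Sierpinski gasket. -/
def f (i : Fin 3) (x : EuclideanSpace ℝ (Fin 2)) : EuclideanSpace ℝ (Fin 2) :=
  (1/2 : ℝ) • x + v i

/-- `fword [i₁, …, i_k] = f_{i₁} ∘ ⋯ ∘ f_{i_k}`. -/
def fword : List (Fin 3) → EuclideanSpace ℝ (Fin 2) → EuclideanSpace ℝ (Fin 2)
  | [] => id
  | i :: l => f i ∘ fword l

/-- The similarity dimension `s = log 3 / log 2`. -/
def sDim : ℝ := Real.log 3 / Real.log 2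

/-- The normalised Hausdorff measure `μ = H^s(S)⁻¹ • H^s⌊S`. -/
def muS (S : Set (EuclideanSpace ℝ (Fin 2))) : Measure (EuclideanSpace ℝ (Fin 2)) :=
  (μH[sDim] S)⁻¹ • (μH[sDim]).restrict S

/-- Fixed points `z_i = 2 v_i`. -/
def z (i : Fin 3) : EuclideanSpace ℝ (Fin 2) := (2 : ℝ) • v i

/-- The Hutchinson operator. -/
def Fop (A : Set (EuclideanSpace ℝ (Fin 2))) : Set (EuclideanSpace ℝ (Fin 2)) :=
  f 0 '' A ∪ f 1 '' A ∪ f 2 '' A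

/-- The discrete approximations `A_k = F^{k-1}(A₁)`, `A₁ = {z₀, z₁, z₂}`. -/
def Aset (k : ℕ) : Set (EuclideanSpace ℝ (Fin 2)) := Fop^[k - 1] {z 0, z 1, z 2}

/-- The discrete measures `μ_k`. -/
def muk (k : ℕ) : Measure (EuclideanSpace ℝ (Fin 2)) :=
  ((3 : ℝ≥0∞)⁻¹ ^ k) • ∑ i : Fin (k - 1) → Fin 3,
    (Measure.dirac (fword (List.ofFn i) (z 0)) + Measure.dirac (fword (List.ofFn i) (z 1)) +
      Measure.dirac (fword (List.ofFn i) (z 2)))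

/-- The centred Hausdorff premeasure `C₀^s(A)` (the limit as `δ → 0⁺` is written as a
supremum over `δ > 0`, the inner infimum being antitone in `δ`). -/
def centredPremeasure (s : ℝ) (A : Set (EuclideanSpace ℝ (Fin 2))) : ℝ≥0∞ :=
  ⨆ (δ : ℝ) (_ : 0 < δ),
    ⨅ (x : ℕ → EuclideanSpace ℝ (Fin 2)) (d : ℕ → ℝ) (_ : ∀ n, x n ∈ A)
      (_ : ∀ n, 0 ≤ d n) (_ : ∀ n, 2 * d n ≤ δ) (_ : A ⊆ ⋃ n, closedBall (x n) (d n)),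
      ∑' n, ENNReal.ofReal ((2 * d n) ^ s)

/-- The reflection across the vertical line `x₁ = 1/2`. -/
def refl2 (x : EuclideanSpace ℝ (Fin 2)) : EuclideanSpace ℝ (Fin 2) := pt (1 - x 0) (x 1)

/-- The reflection across the vertical line `x₁ = 1/4`. -/
def refl4 (x : EuclideanSpace ℝ (Fin 2)) : EuclideanSpace ℝ (Fin 2) := pt (1/2 - x 0) (x 1)

/-- The barycentric coordinates with respect to the triangle `z 0`, `z 1`, `z 2`. -/
def bary (x : EuclideanSpace ℝ (Fin 2)) : Fin 3 → ℝ :=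
  ![1 - x 0 - x 1 / √3, x 0 - x 1 / √3, 2 * (x 1 / √3)]

lemma bary_injective : Function.Injective bary := by
  intro x y h
  have h3 : √3 ≠ 0 := by positivity
  have h1 := congrFun h 1
  have h2 := congrFun h 2
  simp only [bary, Matrix.cons_val] at h1 h2
  have e : x 1 / √3 = y 1 / √3 := by linarith
  have e0 : x 0 = y 0 := by linarith
  have e1 : x 1 = y 1 := by field_simp at e; exact e
  ext i
  fin_cases i
  · exact e0
  · exact e1

lemma bary_sum (x : EuclideanSpace ℝ (Fin 2)) : bary x 0 + bary x 1 + bary x 2 = 1 := by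
  simp only [bary, Matrix.cons_val]
  ring

lemma bary_f (i j : Fin 3) (x : EuclideanSpace ℝ (Fin 2)) :
    bary (f i x) j = (bary x j + if i = j then 1 else 0) / 2 := by
  have h3 : √3 ≠ 0 := by positivity
  fin_cases i <;> fin_cases j <;> simp [bary, f, v, pt] <;> field_simp <;> ring

lemma bary_z (i j : Fin 3) : bary (z i) j = if i = j then 1 else 0 := by
  have h3 : √3 ≠ 0 := by positivity
  fin_cases i <;> fin_cases j <;> simp [bary, z, v, pt] <;> field_simp <;> ring

/-- The closed triangle with vertices `z 0`, `z 1`, `z 2`. -/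
def triangle : Set (EuclideanSpace ℝ (Fin 2)) := {x | ∀ j, 0 ≤ bary x j}

lemma z_mem_triangle (i : Fin 3) : z i ∈ triangle := by
  intro j
  rw [bary_z]
  split_ifs <;> norm_num

lemma f_mem_triangle (i : Fin 3) {x : EuclideanSpace ℝ (Fin 2)} (hx : x ∈ triangle) :
    f i x ∈ triangle := by
  intro j
  have := hx j
  rw [bary_f]
  split_ifs <;> linarith

lemma f_z_self (i : Fin 3) : f i (z i) = z i := by
  unfold f z
  module

lemma f_z_comm (i j : Fin 3) : f i (z j) = f j (z i) := by
  unfold f z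
  module

lemma f_injective (i : Fin 3) : Function.Injective (f i) := by
  intro x y h
  simpa [f] using h

lemma measurable_f (i : Fin 3) : Measurable (f i) := by
  unfold f
  fun_prop

lemma z_injective : Function.Injective z := by
  intro i j h
  by_contra hij
  have := congrFun (congrArg bary h) i
  simp [bary_z, Ne.symm hij] at this

lemma eq_z_of_one_le_bary {x : EuclideanSpace ℝ (Fin 2)} (hx : x ∈ triangle) {i : Fin 3}
    (hi : 1 ≤ bary x i) : x = z i := by
  apply bary_injective
  have hs := bary_sum x
  have h0 := hx 0
  have h1 := hx 1
  have h2 := hx 2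
  ext j
  rw [bary_z]
  fin_cases i <;> fin_cases j <;> simp at hi ⊢ <;> linarith

lemma eq_z_of_f_eq_f {x y : EuclideanSpace ℝ (Fin 2)} (hx : x ∈ triangle) (hy : y ∈ triangle)
    {i j : Fin 3} (hij : i ≠ j) (h : f i x = f j y) : x = z j ∧ y = z i := by
  constructor
  · apply eq_z_of_one_le_bary hx
    have := congrFun (congrArg bary h) j
    simp only [bary_f, if_neg hij, if_true] at this
    linarith [hy j]
  · apply eq_z_of_one_le_bary hy
    have := congrFun (congrArg bary h) i
    simp only [bary_f, if_neg hij.symm, if_true] at this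
    linarith [hx i]

lemma eq_z_of_f_eq_f_z {x : EuclideanSpace ℝ (Fin 2)} (hx : x ∈ triangle) {i j k : Fin 3}
    (h : f i x = f j (z k)) : ∃ l, x = z l := by
  by_cases hij : i = j
  · subst hij
    exact ⟨k, f_injective i h⟩
  · exact ⟨j, (eq_z_of_f_eq_f hx (z_mem_triangle k) hij h).1⟩

lemma f_z_ne_z {i j : Fin 3} (hij : i ≠ j) (k : Fin 3) : f i (z j) ≠ z k := by
  rw [← f_z_self k]
  intro h
  by_cases hik : i = k
  · subst hik
    exact hij (z_injective (f_injective i h)).symm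
  · obtain ⟨h1, h2⟩ := eq_z_of_f_eq_f (z_mem_triangle j) (z_mem_triangle k) hik h
    exact hik (z_injective h2).symm

/-- The sum of the Dirac measures at the points of a set. -/
def diracSum {α : Type*} [MeasurableSpace α] (B : Set α) : Measure α :=
  Measure.sum fun x : B => Measure.dirac (x : α)

section diracSum

variable {α β : Type*} [MeasurableSpace α] [MeasurableSpace β]

lemma diracSum_apply (B : Set α) {s : Set α} (hs : MeasurableSet s) :
    diracSum B s = ∑' x : B, Measure.dirac (x : α) s :=
  Measure.sum_apply _ hs

lemma diracSum_empty : diracSum (∅ : Set α) = 0 := by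
  ext s hs
  simp [diracSum_apply _ hs]

lemma diracSum_singleton (x : α) : diracSum {x} = Measure.dirac x := by
  ext s hs
  rw [diracSum_apply _ hs, tsum_singleton x fun y => Measure.dirac y s]

lemma diracSum_union {A B : Set α} (h : Disjoint A B) :
    diracSum (A ∪ B) = diracSum A + diracSum B := by
  ext s hs
  rw [Measure.add_apply, diracSum_apply _ hs, diracSum_apply _ hs, diracSum_apply _ hs]
  exact ENNReal.summable.tsum_union_disjoint (f := fun y => Measure.dirac y s) h
    ENNReal.summable

lemma map_diracSum {g : α → β} (hg : Measurable g) (hi : Function.Injective g) (B : Set α) :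
    (diracSum B).map g = diracSum (g '' B) := by
  ext s hs
  rw [Measure.map_apply hg hs, diracSum_apply _ hs, diracSum_apply _ (hg hs),
    tsum_image (fun y => Measure.dirac y s) hi.injOn]
  refine tsum_congr fun x => ?_
  rw [Measure.dirac_apply' _ hs, Measure.dirac_apply' _ (hg hs)]
  rfl

end diracSum

/-- The measure `3 ^ (n + 1) • muk (n + 1)`. -/
def wordMeasure (n : ℕ) : Measure (EuclideanSpace ℝ (Fin 2)) :=
  ∑ i : Fin n → Fin 3,
    (Measure.dirac (fword (List.ofFn i) (z 0)) + Measure.dirac (fword (List.ofFn i) (z 1)) +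
      Measure.dirac (fword (List.ofFn i) (z 2)))

lemma wordMeasure_succ (n : ℕ) :
    wordMeasure (n + 1) = ∑ i, (wordMeasure n).map (f i) := by
  unfold wordMeasure
  rw [← (Fin.consEquiv fun _ : Fin (n + 1) => Fin 3).sum_comp, Fintype.sum_prod_type]
  refine Finset.sum_congr rfl fun i _ => ?_
  rw [← Measure.mapₗ_apply_of_measurable (measurable_f i), map_sum]
  refine Finset.sum_congr rfl fun w _ => ?_
  rw [Measure.mapₗ_apply_of_measurable (measurable_f i)]
  simp only [Measure.map_add _ _ (measurable_f i), Measure.map_dirac' (measurable_f i)]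
  simp [Fin.consEquiv, fword]

lemma mem_vertices {x : EuclideanSpace ℝ (Fin 2)} :
    x ∈ ({z 0, z 1, z 2} : Set (EuclideanSpace ℝ (Fin 2))) ↔ ∃ i, x = z i := by
  simp [Fin.exists_fin_succ]

lemma mem_Fop {A : Set (EuclideanSpace ℝ (Fin 2))} {x : EuclideanSpace ℝ (Fin 2)} :
    x ∈ Fop A ↔ ∃ i, ∃ a ∈ A, f i a = x := by
  simp [Fop, Fin.exists_fin_succ, or_assoc]

lemma vertices_subset_iterate (n : ℕ) : {z 0, z 1, z 2} ⊆ Fop^[n] {z 0, z 1, z 2} := by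
  induction n with
  | zero => exact subset_rfl
  | succ n ih =>
    intro x hx
    rw [Function.iterate_succ_apply', mem_Fop]
    obtain ⟨i, rfl⟩ := mem_vertices.1 hx
    exact ⟨i, z i, ih hx, f_z_self i⟩

lemma iterate_subset_triangle (n : ℕ) : Fop^[n] {z 0, z 1, z 2} ⊆ triangle := by
  induction n with
  | zero =>
    intro x hx
    obtain ⟨i, rfl⟩ := mem_vertices.1 hx
    exact z_mem_triangle i
  | succ n ih =>
    intro x hx
    rw [Function.iterate_succ_apply', mem_Fop] at hx
    obtain ⟨i, a, ha, rfl⟩ := hx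
    exact f_mem_triangle i (ih ha)

lemma Fop_diff_vertices {A : Set (EuclideanSpace ℝ (Fin 2))}
    (hV : {z 0, z 1, z 2} ⊆ A) (hT : A ⊆ triangle) :
    Fop A \ {z 0, z 1, z 2} =
      {f 0 (z 1)} ∪ {f 0 (z 2)} ∪ {f 1 (z 2)} ∪ Fop (A \ {z 0, z 1, z 2}) := by
  ext x
  constructor
  · rintro ⟨hx, hxV⟩
    obtain ⟨i, a, ha, rfl⟩ := mem_Fop.1 hx
    by_cases haV : a ∈ ({z 0, z 1, z 2} : Set (EuclideanSpace ℝ (Fin 2)))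
    · left
      obtain ⟨j, rfl⟩ := mem_vertices.1 haV
      have hij : i ≠ j := by
        rintro rfl
        exact hxV (mem_vertices.2 ⟨i, f_z_self i⟩)
      fin_cases i <;> fin_cases j <;>
        simp [f_z_comm 1 0, f_z_comm 2 0, f_z_comm 2 1] at hij ⊢
    · exact Or.inr (mem_Fop.2 ⟨i, a, ⟨ha, haV⟩, rfl⟩)
  · have hM : ∀ i j, i ≠ j → f i (z j) ∈ Fop A \ {z 0, z 1, z 2} := fun i j hij =>
      ⟨mem_Fop.2 ⟨i, z j, hV (mem_vertices.2 ⟨j, rfl⟩), rfl⟩, fun h =>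
        (mem_vertices.1 h).elim fun k hk => f_z_ne_z hij k hk⟩
    rintro (((rfl | rfl) | rfl) | h)
    · exact hM _ _ (by decide)
    · exact hM _ _ (by decide)
    · exact hM _ _ (by decide)
    · obtain ⟨i, a, ⟨ha, haV⟩, rfl⟩ := mem_Fop.1 h
      refine ⟨mem_Fop.2 ⟨i, a, ha, rfl⟩, fun hk => haV (mem_vertices.2 ?_)⟩
      obtain ⟨k, hk⟩ := mem_vertices.1 hk
      exact eq_z_of_f_eq_f_z (hT ha) (hk.trans (f_z_self k).symm)

lemma diracSum_Fop {B : Set (EuclideanSpace ℝ (Fin 2))} (hT : B ⊆ triangle)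
    (hB : ∀ i, z i ∉ B) : diracSum (Fop B) = ∑ i, (diracSum B).map (f i) := by
  have hd : ∀ i j, i ≠ j → Disjoint (f i '' B) (f j '' B) := by
    intro i j hij
    rw [Set.disjoint_left]
    rintro _ ⟨a, ha, rfl⟩ ⟨b, hb, h⟩
    exact hB i ((eq_z_of_f_eq_f (hT ha) (hT hb) hij h.symm).2 ▸ hb)
  simp only [Fin.sum_univ_three, map_diracSum (measurable_f _) (f_injective _)]
  rw [Fop, diracSum_union, diracSum_union (hd 0 1 (by decide))]
  exact (hd 0 2 (by decide)).union_left (hd 1 2 (by decide))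

lemma diracSum_Fop_diff_vertices {A : Set (EuclideanSpace ℝ (Fin 2))}
    (hV : {z 0, z 1, z 2} ⊆ A) (hT : A ⊆ triangle) :
    diracSum (Fop A \ {z 0, z 1, z 2}) =
      Measure.dirac (f 0 (z 1)) + Measure.dirac (f 0 (z 2)) + Measure.dirac (f 1 (z 2)) +
        ∑ i, (diracSum (A \ {z 0, z 1, z 2})).map (f i) := by
  have hB : ∀ i, z i ∉ A \ {z 0, z 1, z 2} := fun i h => h.2 (mem_vertices.2 ⟨i, rfl⟩)
  have h12 : f 0 (z 1) ≠ f 0 (z 2) := fun h =>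
    absurd (z_injective (f_injective 0 h)) (by decide)
  have h13 : f 0 (z 1) ≠ f 1 (z 2) := fun h => by
    rw [f_z_comm 0 1] at h
    exact absurd (z_injective (f_injective 1 h)) (by decide)
  have h23 : f 0 (z 2) ≠ f 1 (z 2) := fun h => by
    rw [f_z_comm 0 2, f_z_comm 1 2] at h
    exact absurd (z_injective (f_injective 2 h)) (by decide)
  have hM : ∀ i j, f i (z j) ∉ Fop (A \ {z 0, z 1, z 2}) := by
    intro i j h
    obtain ⟨k, a, ha, h⟩ := mem_Fop.1 h
    obtain ⟨l, rfl⟩ := eq_z_of_f_eq_f_z (hT ha.1) h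
    exact hB l ha
  rw [Fop_diff_vertices hV hT, diracSum_union, diracSum_union, diracSum_union,
    diracSum_singleton, diracSum_singleton, diracSum_singleton,
    diracSum_Fop (sdiff_subset.trans hT) hB]
  · simpa using h12
  · simp [h13.symm, h23.symm]
  · simp [hM]

lemma wordMeasure_eq (n : ℕ) :
    wordMeasure n = Measure.dirac (z 0) + Measure.dirac (z 1) + Measure.dirac (z 2) +
      (2 : ℝ≥0∞) • diracSum (Fop^[n] {z 0, z 1, z 2} \ {z 0, z 1, z 2}) := by
  induction n with
  | zero => simp [wordMeasure, fword, diracSum_empty]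
  | succ n ih =>
    rw [wordMeasure_succ, ih, Function.iterate_succ_apply',
      diracSum_Fop_diff_vertices (vertices_subset_iterate n) (iterate_subset_triangle n)]
    simp only [Fin.sum_univ_three, Measure.map_add _ _ (measurable_f _),
      Measure.map_dirac' (measurable_f _), f_z_self, f_z_comm 1 0, f_z_comm 2 0, f_z_comm 2 1,
      smul_add, two_smul]
    abel

theorem statement12 (k : ℕ) (hk : 2 ≤ k) :
    muk k = ((3 : ℝ≥0∞)⁻¹ ^ k) •
        (Measure.dirac (z 0) + Measure.dirac (z 1) + Measure.dirac (z 2)) +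
      (2 * (3 : ℝ≥0∞)⁻¹ ^ k) •
        Measure.sum (fun x : ↥(Aset k \ Aset 1) =>
          Measure.dirac (x : EuclideanSpace ℝ (Fin 2))) := by
  have h := wordMeasure_eq (k - 1)
  change _ • wordMeasure (k - 1) = _ + _ • diracSum (Aset k \ Aset 1)
  rw [h, smul_add, smul_smul, mul_comm _ (2 : ℝ≥0∞)]
  rfl

end
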